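/- Let n₁,n₂ ≥ 2, 0 ≠ C ∈ H_{n₁n₂} Hermitian on ℂ^{n₁}⊗ℂ^{n₂}, and let ρ₁ ∈ H_{n₁,++,1}, ρ₂ ∈ H_{n₂,++,1} be positive definite density matrices. Suppose (X,Y) ∈ H_{n₁}×H_{n₂} satisfies: C(X,Y) = C − X⊗I_{n₂} − I_{n₁}⊗Y ⪰ 0, tr(ρ₁X) + tr(ρ₂Y) ≥ λ_min(C), and tr X = tr Y. Then ‖(X,Y)‖_F = √(‖X‖_F² + ‖Y‖_F²) < √(max(n₁,n₂))·2‖C‖₂/(λ_min(ρ₁)·λ_min(ρ₂)), where ‖C‖₂ is the spectral norm of C and λ_min denotes the smallest eigenvalue. -/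

import Mathlib

open scoped Kronecker ComplexOrder Matrix

namespace Matrix

variable {m n : Type*} [Fintype m] [Fintype n] [DecidableEq m] [DecidableEq n]

/-- A Hermitian matrix whose eigenvalues are at most `c` is dominated by `c • 1`. -/
lemma IsHermitian.posSemidef_smul_one_sub {A : Matrix n n ℂ} (hA : A.IsHermitian) {c : ℝ}
    (h : ∀ i, hA.eigenvalues i ≤ c) : ((c : ℂ) • (1 : Matrix n n ℂ) - A).PosSemidef := by
  have hU : (hA.eigenvectorUnitary : Matrix n n ℂ) * (hA.eigenvectorUnitary : Matrix n n ℂ)ᴴ = 1 :=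
    Unitary.coe_mul_star_self hA.eigenvectorUnitary
  have hd : (diagonal fun i => ((c - hA.eigenvalues i : ℝ) : ℂ)).PosSemidef :=
    posSemidef_diagonal_iff.mpr fun i => by
      exact_mod_cast sub_nonneg.mpr (h i)
  have key := hd.mul_mul_conjTranspose_same (hA.eigenvectorUnitary : Matrix n n ℂ)
  convert key using 1
  have hs := hA.spectral_theorem
  rw [Unitary.conjStarAlgAut_apply] at hs
  have hD : (diagonal fun i => ((c - hA.eigenvalues i : ℝ) : ℂ))
      = (c : ℂ) • (1 : Matrix n n ℂ) - diagonal (RCLike.ofReal ∘ hA.eigenvalues) := by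
    rw [smul_one_eq_diagonal, diagonal_sub]
    congr 1
    ext i
    simp
  rw [hD, mul_sub, sub_mul, mul_smul_comm, smul_mul_assoc, mul_one, hU]
  congr 1

/-- A Hermitian matrix whose eigenvalues are at least `c` dominates `c • 1`. -/
lemma IsHermitian.posSemidef_sub_smul_one {A : Matrix n n ℂ} (hA : A.IsHermitian) {c : ℝ}
    (h : ∀ i, c ≤ hA.eigenvalues i) : (A - (c : ℂ) • (1 : Matrix n n ℂ)).PosSemidef := by
  have hU : (hA.eigenvectorUnitary : Matrix n n ℂ) * (hA.eigenvectorUnitary : Matrix n n ℂ)ᴴ = 1 :=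
    Unitary.coe_mul_star_self hA.eigenvectorUnitary
  have hd : (diagonal fun i => ((hA.eigenvalues i - c : ℝ) : ℂ)).PosSemidef :=
    posSemidef_diagonal_iff.mpr fun i => by
      exact_mod_cast sub_nonneg.mpr (h i)
  have key := hd.mul_mul_conjTranspose_same (hA.eigenvectorUnitary : Matrix n n ℂ)
  convert key using 1
  have hs := hA.spectral_theorem
  rw [Unitary.conjStarAlgAut_apply] at hs
  have hD : (diagonal fun i => ((hA.eigenvalues i - c : ℝ) : ℂ))
      = diagonal (RCLike.ofReal ∘ hA.eigenvalues) - (c : ℂ) • (1 : Matrix n n ℂ) := by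
    rw [smul_one_eq_diagonal, diagonal_sub]
    congr 1
    ext i
    simp
  rw [hD, mul_sub, sub_mul, mul_smul_comm, smul_mul_assoc, mul_one, hU]
  congr 1

open scoped MatrixOrder in
lemma PosSemidef.trace_mul_nonneg {A B : Matrix n n ℂ} (hA : A.PosSemidef) (hB : B.PosSemidef) :
    0 ≤ (A * B).trace := by
  obtain ⟨a, rfl⟩ := CStarAlgebra.nonneg_iff_eq_star_mul_self.mp hA.nonneg
  rw [star_eq_conjTranspose, mul_assoc, trace_mul_comm]
  exact (hB.mul_mul_conjTranspose_same a).trace_nonneg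

/-- For a positive semidefinite matrix the trace of the square is at most the squared trace. -/
lemma PosSemidef.trace_mul_self_re_le {A : Matrix n n ℂ} (hA : A.PosSemidef) :
    (A * A).trace.re ≤ A.trace.re ^ 2 := by
  have htr : A.trace = ((∑ i, hA.1.eigenvalues i : ℝ) : ℂ) := by
    rw [hA.1.trace_eq_sum_eigenvalues]
    simp
  have h1 := hA.1.posSemidef_smul_one_sub (c := ∑ i, hA.1.eigenvalues i) fun i =>
    Finset.single_le_sum (f := hA.1.eigenvalues) (fun j _ => hA.eigenvalues_nonneg j)
      (Finset.mem_univ i)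
  have h2 := (Complex.le_def.mp (hA.trace_mul_nonneg h1)).1
  rw [mul_sub, mul_smul_comm, mul_one, trace_sub, trace_smul, htr] at h2
  rw [htr]
  simp only [Complex.zero_re, Complex.sub_re, smul_eq_mul, ← Complex.ofReal_mul,
    Complex.ofReal_re] at h2 ⊢
  linarith

/-- If `a • 1 - k • X` is positive semidefinite with trace `S`, the Frobenius norm of `k • X` is
controlled by `a` and `S`. -/
lemma IsHermitian.frobenius_le_of_posSemidef {X : Matrix n n ℂ} (hX : X.IsHermitian) {a k S : ℝ}
    (hA : ((a : ℂ) • (1 : Matrix n n ℂ) - (k : ℂ) • X).PosSemidef)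
    (hS : Fintype.card n * a - k * X.trace.re = S) :
    k ^ 2 * (Xᴴ * X).trace.re ≤ Fintype.card n * a ^ 2 - 2 * a * S + S ^ 2 := by
  have h := hA.trace_mul_self_re_le
  have htr : ((a : ℂ) • (1 : Matrix n n ℂ) - (k : ℂ) • X).trace.re = S := by
    rw [← hS]
    simp [mul_comm]
  rw [htr] at h
  rw [hX.eq]
  have hexp : (((a : ℂ) • (1 : Matrix n n ℂ) - (k : ℂ) • X)
      * ((a : ℂ) • (1 : Matrix n n ℂ) - (k : ℂ) • X)).trace.re
      = a ^ 2 * Fintype.card n - 2 * a * k * X.trace.re + k ^ 2 * (X * X).trace.re := by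
    simp only [sub_mul, mul_sub, smul_mul_assoc, mul_smul_comm, one_mul, mul_one, trace_sub,
      trace_smul, trace_one, smul_eq_mul, Complex.sub_re, Complex.re_ofReal_mul,
      Complex.natCast_re]
    ring
  rw [hexp] at h
  have : a * S = a * (Fintype.card n * a - k * X.trace.re) := by rw [hS]
  linarith

/-- Tracing out the second factor of `c • 1 - X ⊗ 1 - 1 ⊗ Y`. -/
lemma posSemidef_of_kronecker_left {ι κ : Type*} [DecidableEq ι] [Fintype κ] [DecidableEq κ]
    {X : Matrix ι ι ℂ} {Y : Matrix κ κ ℂ} {c : ℂ}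
    (h : (c • (1 : Matrix (ι × κ) (ι × κ) ℂ) - X ⊗ₖ (1 : Matrix κ κ ℂ)
      - (1 : Matrix ι ι ℂ) ⊗ₖ Y).PosSemidef) :
    ((Fintype.card κ * c - Y.trace) • (1 : Matrix ι ι ℂ)
      - (Fintype.card κ : ℂ) • X).PosSemidef := by
  convert posSemidef_sum Finset.univ fun (j : κ) _ => h.submatrix fun i : ι => (i, j) using 1
  ext i i'
  by_cases hi : i = i'
  · subst hi
    simp [sum_apply, trace]
    ring
  · simp [sum_apply, hi]

/-- Tracing out the first factor of `c • 1 - X ⊗ 1 - 1 ⊗ Y`. -/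
lemma posSemidef_of_kronecker_right {ι κ : Type*} [Fintype ι] [DecidableEq ι] [DecidableEq κ]
    {X : Matrix ι ι ℂ} {Y : Matrix κ κ ℂ} {c : ℂ}
    (h : (c • (1 : Matrix (ι × κ) (ι × κ) ℂ) - X ⊗ₖ (1 : Matrix κ κ ℂ)
      - (1 : Matrix ι ι ℂ) ⊗ₖ Y).PosSemidef) :
    ((Fintype.card ι * c - X.trace) • (1 : Matrix κ κ ℂ)
      - (Fintype.card ι : ℂ) • Y).PosSemidef := by
  convert posSemidef_sum Finset.univ fun (i : ι) _ => h.submatrix fun j : κ => (i, j) using 1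
  ext j j'
  by_cases hj : j = j'
  · subst hj
    simp [sum_apply, trace]
  · simp [sum_apply, hj]

/-- Lower bounds on the spectra of `ρ₁` and `ρ₂` bound the trace of a positive semidefinite matrix
by its pairing with `ρ₁ ⊗ ρ₂`. -/
lemma mul_trace_re_le_trace_kronecker_mul {ρ₁ : Matrix m m ℂ} {ρ₂ : Matrix n n ℂ} {l₁ l₂ : ℝ}
    (hρ₂ : ρ₂.PosSemidef) (hl₁ : 0 ≤ l₁)
    (h₁ : (ρ₁ - (l₁ : ℂ) • (1 : Matrix m m ℂ)).PosSemidef)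
    (h₂ : (ρ₂ - (l₂ : ℂ) • (1 : Matrix n n ℂ)).PosSemidef)
    {M : Matrix (m × n) (m × n) ℂ} (hM : M.PosSemidef) :
    l₁ * l₂ * M.trace.re ≤ ((ρ₁ ⊗ₖ ρ₂) * M).trace.re := by
  have hl : ((l₁ : ℂ) • (1 : Matrix m m ℂ)).PosSemidef :=
    PosSemidef.one.smul (by exact_mod_cast hl₁)
  have h := (Complex.le_def.mp
    (((h₁.kronecker hρ₂).add (hl.kronecker h₂)).trace_mul_nonneg hM)).1
  have hexp : (ρ₁ - (l₁ : ℂ) • (1 : Matrix m m ℂ)) ⊗ₖ ρ₂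
      + ((l₁ : ℂ) • (1 : Matrix m m ℂ)) ⊗ₖ (ρ₂ - (l₂ : ℂ) • (1 : Matrix n n ℂ))
      = ρ₁ ⊗ₖ ρ₂ - ((l₁ * l₂ : ℝ) : ℂ) • (1 : Matrix (m × n) (m × n) ℂ) := by
    rw [← one_kronecker_one (m := m) (n := n)]
    ext i j
    simp only [add_apply, sub_apply, smul_apply, kroneckerMap_apply, smul_eq_mul]
    push_cast
    ring
  rw [hexp, sub_mul, smul_mul_assoc, one_mul, trace_sub, trace_smul, smul_eq_mul,
    Complex.sub_re, Complex.re_ofReal_mul, Complex.zero_re] at h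
  linarith

end Matrix

/-- Arithmetic core of the a priori bound: `S` is the trace of `c • 1 - X ⊗ 1 - 1 ⊗ Y`, `t` the
common trace of `X` and `Y`, and `F`, `G` their squared Frobenius norms. -/
lemma add_lt_max_mul_sq_of_trace_bounds {N₁ N₂ c t S R F G : ℝ} (h₁ : 2 ≤ N₁) (h₂ : 2 ≤ N₂)
    (hc : 0 < c) (hS : N₁ * N₂ * c - (N₁ + N₂) * t = S) (hS0 : 0 ≤ S) (hSR : S ≤ R)
    (hcR : 2 * (N₁ * N₂ * c) ≤ R)
    (hF : N₂ ^ 2 * F ≤ N₁ * (N₂ * c - t) ^ 2 - 2 * (N₂ * c - t) * S + S ^ 2)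
    (hG : N₁ ^ 2 * G ≤ N₂ * (N₁ * c - t) ^ 2 - 2 * (N₁ * c - t) * S + S ^ 2) :
    F + G < max N₁ N₂ * R ^ 2 := by
  have hR : 0 < R := lt_of_lt_of_le (by positivity) hcR
  have hsum : 0 < N₁ + N₂ := by linarith
  have aux : ∀ {N K H : ℝ}, 2 ≤ N → 2 ≤ K → N * K * c - (N + K) * t = S →
      2 * (N * K * c) ≤ R →
      K ^ 2 * H ≤ N * (K * c - t) ^ 2 - 2 * (K * c - t) * S + S ^ 2 →
      H < N * R ^ 2 / 2 := by
    intro N K H hN hK hS' hcR' hH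
    have hα0 : 0 ≤ K * c - t := by
      have : 0 ≤ (N + K) * (K * c - t) := by nlinarith [mul_pos hc (show 0 < K * K by positivity)]
      exact nonneg_of_mul_nonneg_right this (by linarith)
    have hα : K * c - t ≤ 3 / 16 * (K * R) := by
      have hKc : 4 * (K * c) ≤ R := by nlinarith [mul_pos (show 0 < K by linarith) hc]
      have hKR : 0 < K * R := by positivity
      refine le_of_mul_le_mul_left ?_ (show 0 < N + K by linarith)
      calc (N + K) * (K * c - t) = K * (K * c) + S := by linarith
        _ ≤ 4 * (3 / 16 * (K * R)) := by nlinarith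
        _ ≤ (N + K) * (3 / 16 * (K * R)) :=
          mul_le_mul_of_nonneg_right (by linarith) (by positivity)
    have hα2 : (K * c - t) ^ 2 ≤ (3 / 16 * (K * R)) ^ 2 := pow_le_pow_left₀ hα0 hα 2
    have hS2 : S ^ 2 ≤ R ^ 2 := pow_le_pow_left₀ hS0 hSR 2
    have hαS : 0 ≤ (K * c - t) * S := mul_nonneg hα0 hS0
    have hNα : N * (K * c - t) ^ 2 ≤ N * (3 / 16 * (K * R)) ^ 2 :=
      mul_le_mul_of_nonneg_left hα2 (by linarith)
    have hKN : 8 * R ^ 2 ≤ K ^ 2 * N * R ^ 2 :=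
      mul_le_mul_of_nonneg_right (by nlinarith) (by positivity)
    refine lt_of_mul_lt_mul_left ?_ (show 0 ≤ K ^ 2 by positivity)
    nlinarith [pow_pos hR 2]
  have hF' := aux h₁ h₂ hS hcR hF
  have hG' := aux (H := G) h₂ h₁ (by linarith) (by linarith) hG
  nlinarith [mul_le_mul_of_nonneg_right (le_max_left N₁ N₂) (sq_nonneg R),
    mul_le_mul_of_nonneg_right (le_max_right N₁ N₂) (sq_nonneg R)]

/-- A priori bound on the dual variables of the quantum bi-partite OTP (Lemma 4.3 (c)):
if `C − X⊗I − I⊗Y ⪰ 0`, `tr(ρ₁X) + tr(ρ₂Y) ≥ λ_min(C)` and `tr X = tr Y`, then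
`√(‖X‖_F² + ‖Y‖_F²) < √(max(n₁,n₂)) · 2‖C‖₂ / (λ_min(ρ₁) λ_min(ρ₂))`. -/
theorem stmt_18 (n₁ n₂ : ℕ) (hn₁ : 2 ≤ n₁) (hn₂ : 2 ≤ n₂)
    (C : Matrix (Fin n₁ × Fin n₂) (Fin n₁ × Fin n₂) ℂ) (hC : C.IsHermitian) (hC0 : C ≠ 0)
    (ρ₁ : Matrix (Fin n₁) (Fin n₁) ℂ) (ρ₂ : Matrix (Fin n₂) (Fin n₂) ℂ)
    (hρ₁ : ρ₁.PosDef) (hρ₂ : ρ₂.PosDef)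
    (htr₁ : ρ₁.trace = 1) (htr₂ : ρ₂.trace = 1)
    (X : Matrix (Fin n₁) (Fin n₁) ℂ) (Y : Matrix (Fin n₂) (Fin n₂) ℂ)
    (hX : X.IsHermitian) (hY : Y.IsHermitian)
    (hpsd : (C - X ⊗ₖ (1 : Matrix (Fin n₂) (Fin n₂) ℂ)
      - (1 : Matrix (Fin n₁) (Fin n₁) ℂ) ⊗ₖ Y).PosSemidef)
    (hpay : ((ρ₁ * X).trace).re + ((ρ₂ * Y).trace).re ≥ ⨅ i, hC.eigenvalues i)
    (htrXY : X.trace = Y.trace) :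
    Real.sqrt (((Xᴴ * X).trace).re + ((Yᴴ * Y).trace).re)
      < Real.sqrt (max n₁ n₂ : ℕ) * (2 * ⨆ i, |hC.eigenvalues i|)
        / ((⨅ i, hρ₁.1.eigenvalues i) * ⨅ i, hρ₂.1.eigenvalues i) := by
  have : NeZero n₁ := ⟨by omega⟩
  have : NeZero n₂ := ⟨by omega⟩
  set c : ℝ := ⨆ i, |hC.eigenvalues i| with hcdef
  set l₁ : ℝ := ⨅ i, hρ₁.1.eigenvalues i with hl₁def
  set l₂ : ℝ := ⨅ i, hρ₂.1.eigenvalues i with hl₂def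
  have hle₁ : ∀ i, l₁ ≤ hρ₁.1.eigenvalues i := ciInf_le (Set.finite_range _).bddBelow
  have hle₂ : ∀ i, l₂ ≤ hρ₂.1.eigenvalues i := ciInf_le (Set.finite_range _).bddBelow
  have hlec : ∀ i, |hC.eigenvalues i| ≤ c :=
    le_ciSup (f := fun i => |hC.eigenvalues i|) (Set.finite_range _).bddAbove
  have hl₁ : 0 < l₁ := by
    obtain ⟨i, hi⟩ := exists_eq_ciInf_of_finite (f := hρ₁.1.eigenvalues)
    rw [hl₁def, ← hi]
    exact hρ₁.eigenvalues_pos i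
  have hl₂ : 0 < l₂ := by
    obtain ⟨i, hi⟩ := exists_eq_ciInf_of_finite (f := hρ₂.1.eigenvalues)
    rw [hl₂def, ← hi]
    exact hρ₂.eigenvalues_pos i
  have hc : 0 < c := by
    obtain ⟨i, hi⟩ := Function.ne_iff.mp (mt hC.eigenvalues_eq_zero_iff.mp hC0)
    exact (abs_pos.mpr hi).trans_le (hlec i)
  have hmin : -c ≤ ⨅ i, hC.eigenvalues i :=
    le_ciInf fun i => (abs_le.mp (hlec i)).1
  have hP₁ := hρ₁.1.posSemidef_sub_smul_one hle₁
  have hP₂ := hρ₂.1.posSemidef_sub_smul_one hle₂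
  have hM : ((c : ℂ) • (1 : Matrix (Fin n₁ × Fin n₂) (Fin n₁ × Fin n₂) ℂ)
      - X ⊗ₖ (1 : Matrix (Fin n₂) (Fin n₂) ℂ)
      - (1 : Matrix (Fin n₁) (Fin n₁) ℂ) ⊗ₖ Y).PosSemidef := by
    convert (hC.posSemidef_smul_one_sub fun i => (abs_le.mp (hlec i)).2).add hpsd using 1
    abel
  obtain ⟨t, ht⟩ : ∃ t : ℝ, X.trace = t := ⟨_, by rw [hX.trace_eq_sum_eigenvalues]; norm_cast⟩
  have htY : Y.trace = t := htrXY ▸ ht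
  have hA := Matrix.posSemidef_of_kronecker_left hM
  have hB := Matrix.posSemidef_of_kronecker_right hM
  rw [htY, Fintype.card_fin] at hA
  rw [ht, Fintype.card_fin] at hB
  have htrM : ((c : ℂ) • (1 : Matrix (Fin n₁ × Fin n₂) (Fin n₁ × Fin n₂) ℂ)
      - X ⊗ₖ (1 : Matrix (Fin n₂) (Fin n₂) ℂ)
      - (1 : Matrix (Fin n₁) (Fin n₁) ℂ) ⊗ₖ Y).trace.re = n₁ * n₂ * c - (n₁ + n₂) * t := by
    simp [Matrix.trace_sub, Matrix.trace_kronecker, ht, htY]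
    ring
  have hS0 : 0 ≤ n₁ * n₂ * c - (n₁ + n₂) * t := htrM ▸ (Complex.le_def.mp hM.trace_nonneg).1
  have hpair := Matrix.mul_trace_re_le_trace_kronecker_mul hρ₂.posSemidef hl₁.le hP₁ hP₂ hM
  have hpair' : ((ρ₁ ⊗ₖ ρ₂) * ((c : ℂ) • (1 : Matrix (Fin n₁ × Fin n₂) (Fin n₁ × Fin n₂) ℂ)
      - X ⊗ₖ (1 : Matrix (Fin n₂) (Fin n₂) ℂ)
      - (1 : Matrix (Fin n₁) (Fin n₁) ℂ) ⊗ₖ Y)).trace.re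
      = c - (ρ₁ * X).trace.re - (ρ₂ * Y).trace.re := by
    simp [Matrix.mul_sub, ← Matrix.mul_kronecker_mul, Matrix.trace_sub, Matrix.trace_kronecker,
      htr₁, htr₂]
  rw [htrM, hpair'] at hpair
  have hcard₁ : l₁ * n₁ ≤ 1 := by
    have := (Complex.le_def.mp hP₁.trace_nonneg).1
    simpa [Matrix.trace_sub, htr₁] using this
  have hcard₂ : l₂ * n₂ ≤ 1 := by
    have := (Complex.le_def.mp hP₂.trace_nonneg).1
    simpa [Matrix.trace_sub, htr₂] using this
  have hl : 0 < l₁ * l₂ := mul_pos hl₁ hl₂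
  have hSR : n₁ * n₂ * c - (n₁ + n₂) * t ≤ 2 * c / (l₁ * l₂) := by
    rw [le_div_iff₀ hl]
    linarith
  have hcR : 2 * (n₁ * n₂ * c) ≤ 2 * c / (l₁ * l₂) := by
    rw [le_div_iff₀ hl]
    have : l₁ * n₁ * (l₂ * n₂) ≤ 1 := mul_le_one₀ hcard₁ (by positivity) hcard₂
    nlinarith
  have hF := hX.frobenius_le_of_posSemidef (a := n₂ * c - t) (k := n₂)
    (S := n₁ * n₂ * c - (n₁ + n₂) * t) (by exact_mod_cast hA) (by simp [ht]; ring)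
  have hG := hY.frobenius_le_of_posSemidef (a := n₁ * c - t) (k := n₁)
    (S := n₁ * n₂ * c - (n₁ + n₂) * t) (by exact_mod_cast hB) (by simp [htY]; ring)
  rw [Fintype.card_fin] at hF hG
  have hlt := add_lt_max_mul_sq_of_trace_bounds (by exact_mod_cast hn₁) (by exact_mod_cast hn₂) hc
    rfl hS0 hSR hcR hF hG
  have hR : 0 < 2 * c / (l₁ * l₂) := by positivity
  rw [mul_div_assoc]
  refine (Real.sqrt_lt' (mul_pos (Real.sqrt_pos.mpr ?_) hR)).mpr ?_
  · exact_mod_cast lt_of_lt_of_le (by omega : 0 < n₁) (le_max_left _ _)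
  · rw [mul_pow, Real.sq_sqrt (Nat.cast_nonneg _), Nat.cast_max]
    exact hlt
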